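/- arXiv:1912.06424 — 2 statements merged into one kernel-verified Lean document; each statement's English description precedes it below -/
import Mathlib

section
/- Let z ∈ ℂ with Im(z) > 0 and let c ∈ ℝ with c ≥ 0. Then there exists a unique w ∈ ℂ with Im(w) > 0 and w² = z² − c; moreover this w satisfies Im(w) ≥ Im(z). -/
open Complex

theorem Complex.sq_eq_sq_sub_ofReal_iff (w z : ℂ) (c : ℝ) :
    w ^ 2 = z ^ 2 - (c : ℂ) ↔
      w.re ^ 2 - w.im ^ 2 = z.re ^ 2 - z.im ^ 2 - c ∧ w.re * w.im = z.re * z.im := by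
  simp only [Complex.ext_iff, sq, mul_re, mul_im, sub_re, sub_im, ofReal_re, ofReal_im]
  constructor <;> rintro ⟨h₁, h₂⟩ <;> constructor <;> linarith

theorem Complex.exists_im_pos_sq_eq_sq_sub {z : ℂ} (hz : 0 < z.im) {c : ℝ} (hc : 0 ≤ c) :
    ∃ w : ℂ, 0 < w.im ∧ w ^ 2 = z ^ 2 - (c : ℂ) := by
  obtain ⟨u, hu⟩ := IsAlgClosed.exists_pow_nat_eq (z ^ 2 - (c : ℂ)) two_pos
  rcases lt_trichotomy u.im 0 with h | h | h
  · exact ⟨-u, by simpa using h, by rw [neg_sq, hu]⟩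
  · obtain ⟨h₁, h₂⟩ := (sq_eq_sq_sub_ofReal_iff u z c).1 hu
    have hre : z.re = 0 := by
      rw [h, mul_zero] at h₂
      exact (mul_eq_zero.1 h₂.symm).resolve_right hz.ne'
    rw [h, hre] at h₁
    nlinarith [sq_nonneg u.re, pow_pos hz 2]
  · exact ⟨u, h, hu⟩

theorem Complex.eq_of_sq_eq_sq_of_im_pos {u w : ℂ} (hu : 0 < u.im) (hw : 0 < w.im)
    (h : u ^ 2 = w ^ 2) : u = w := by
  refine (sq_eq_sq_iff_eq_or_eq_neg.1 h).resolve_right fun hneg => ?_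
  rw [hneg, neg_im] at hu
  linarith

theorem Complex.im_le_im_of_sq_eq_sq_sub {z w : ℂ} {c : ℝ} (hc : 0 ≤ c)
    (hw : 0 < w.im) (h : w ^ 2 = z ^ 2 - (c : ℂ)) : z.im ≤ w.im := by
  obtain ⟨h₁, h₂⟩ := (sq_eq_sq_sub_ofReal_iff w z c).1 h
  by_contra! hlt
  have him : w.im ^ 2 < z.im ^ 2 := by gcongr
  have hre : w.re ^ 2 < z.re ^ 2 := by linarith
  have hlt' : w.re ^ 2 * w.im ^ 2 < z.re ^ 2 * z.im ^ 2 :=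
    mul_lt_mul hre him.le (by positivity) (by positivity)
  rw [← mul_pow, ← mul_pow, h₂] at hlt'
  exact lt_irrefl _ hlt'

/-- For `z` in the upper half-plane and `c ≥ 0` there is a unique square root of
`z² - c` in the upper half-plane, and its imaginary part is at least `Im z`. -/
theorem stmt10 (z : ℂ) (hz : 0 < z.im) (c : ℝ) (hc : 0 ≤ c) :
    (∃! w : ℂ, 0 < w.im ∧ w ^ 2 = z ^ 2 - (c : ℂ)) ∧
    ∀ w : ℂ, 0 < w.im → w ^ 2 = z ^ 2 - (c : ℂ) → z.im ≤ w.im := by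
  obtain ⟨w, hw, hwz⟩ := exists_im_pos_sq_eq_sq_sub hz hc
  exact ⟨⟨w, ⟨hw, hwz⟩, fun u hu => eq_of_sq_eq_sq_of_im_pos hu.1 hw (hu.2.trans hwz.symm)⟩,
    fun _ => im_le_im_of_sq_eq_sq_sub hc⟩
end

section
/- Let (Ω, 𝓕, P) be a probability space, κ > 0, N ≥ 1, and let 0 = t₀ < t₁ < ⋯ < t_N be a partition with step sizes h_k = t_{k+1} − t_k. Let Z_k : Ω → ℂ (0 ≤ k ≤ N), S_k : Ω → ℂ and ξ_k : Ω → ℝ (0 ≤ k ≤ N−1) be random variables such that for each k: S_k² = Z_k² − 2h_k almost surely; Z_{k+1}² = (S_k + √κ·ξ_k)² − 2h_k almost surely; Z_k² is integrable; S_k is integrable; ξ_k has the Gaussian law N(0, h_k); and S_k and ξ_k are independent. Then for every 0 ≤ k ≤ N, E[Z_k²] = E[Z_0²] + (κ − 4)·t_k, where expectations of complex random variables are Bochner integrals. -/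
open MeasureTheory ProbabilityTheory Complex

theorem ProbabilityTheory.HasLaw.memLp_gaussianReal {Ω : Type*} [MeasurableSpace Ω]
    {P : Measure Ω} {Y : Ω → ℝ} {m : ℝ} {v : NNReal} (hY : HasLaw Y (gaussianReal m v) P)
    (p : NNReal) : MemLp Y p P := by
  have h := memLp_id_gaussianReal (μ := m) (v := v) p
  rw [← hY.map_eq] at h
  exact h.comp_of_map hY.aemeasurable

theorem ProbabilityTheory.HasLaw.integral_sq_gaussianReal {Ω : Type*} [MeasurableSpace Ω]
    {P : Measure Ω} {Y : Ω → ℝ} {v : NNReal} (hY : HasLaw Y (gaussianReal 0 v) P) :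
    ∫ ω, Y ω ^ 2 ∂P = v := by
  rw [← variance_of_integral_eq_zero hY.aemeasurable
    (by rw [hY.integral_eq, integral_id_gaussianReal]), hY.variance_eq, variance_id_gaussianReal]

/-- Adding an independent centered real noise to a complex random variable shifts its
(non-Hermitian) second moment by the second moment of the noise. -/
theorem ProbabilityTheory.IndepFun.integral_add_mul_ofReal_sq {Ω : Type*} [MeasurableSpace Ω]
    {P : Measure Ω} [IsProbabilityMeasure P] {X : Ω → ℂ} {Y : Ω → ℝ} (hXY : IndepFun X Y P)
    (hX : Integrable X P) (hX2 : Integrable (fun ω => X ω ^ 2) P) (hY : MemLp Y 2 P)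
    (hY0 : ∫ ω, Y ω ∂P = 0) (c : ℂ) :
    Integrable (fun ω => (X ω + c * (Y ω : ℂ)) ^ 2) P ∧
      ∫ ω, (X ω + c * (Y ω : ℂ)) ^ 2 ∂P
        = (∫ ω, X ω ^ 2 ∂P) + c ^ 2 * ((∫ ω, Y ω ^ 2 ∂P : ℝ) : ℂ) := by
  have hYc : Integrable (fun ω => (Y ω : ℂ)) P := (hY.integrable one_le_two).ofReal
  have hY2 : Integrable (fun ω => ((Y ω ^ 2 : ℝ) : ℂ)) P := hY.integrable_sq.ofReal
  have hindep : IndepFun X (fun ω => (Y ω : ℂ)) P := hXY.comp measurable_id measurable_ofReal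
  have hmul : Integrable (fun ω => X ω * (Y ω : ℂ)) P := hindep.integrable_mul hX hYc
  have hmul0 : ∫ ω, X ω * (Y ω : ℂ) ∂P = 0 := by
    rw [hindep.integral_fun_mul_eq_mul_integral hX.1 hYc.1, integral_complex_ofReal, hY0,
      ofReal_zero, mul_zero]
  have hcross := hmul.const_mul (2 * c)
  have hsq := hY2.const_mul (c ^ 2)
  have hexpand : (fun ω => (X ω + c * (Y ω : ℂ)) ^ 2) = fun ω =>
      X ω ^ 2 + 2 * c * (X ω * (Y ω : ℂ)) + c ^ 2 * ((Y ω ^ 2 : ℝ) : ℂ) := by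
    funext ω
    push_cast
    ring
  rw [hexpand]
  refine ⟨(hX2.add hcross).add hsq, ?_⟩
  rw [integral_add (hX2.fun_add hcross) hsq, integral_add hX2 hcross, integral_const_mul,
    integral_const_mul, hmul0, integral_complex_ofReal]
  ring

/-- The Ninomiya-Victoir scheme for the backward Loewner equation preserves the
second-moment evolution of the true diffusion: along a partition
`0 = t₀ < t₁ < ⋯ < t_N` with steps `h_k = t_{k+1} - t_k`, if
`S_k² = Z_k² - 2h_k` and `Z_{k+1}² = (S_k + √κ ξ_k)² - 2h_k` a.s., with
`ξ_k ~ N(0, h_k)` independent of `S_k`, then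
`E[Z_k²] = E[Z_0²] + (κ - 4) t_k` for all `k ≤ N`. -/
theorem stmt13 {Ω : Type*} [MeasurableSpace Ω] (P : Measure Ω) [IsProbabilityMeasure P]
    (κ : ℝ) (hκ : 0 < κ) (N : ℕ) (hN : 1 ≤ N)
    (t : ℕ → ℝ) (ht0 : t 0 = 0) (hmono : ∀ k < N, t k < t (k + 1))
    (Z S : ℕ → Ω → ℂ) (ξ : ℕ → Ω → ℝ)
    (hSsq : ∀ k < N, ∀ᵐ ω ∂P,
      S k ω ^ 2 = Z k ω ^ 2 - 2 * ((t (k + 1) - t k : ℝ) : ℂ))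
    (hstep : ∀ k < N, ∀ᵐ ω ∂P,
      Z (k + 1) ω ^ 2
        = (S k ω + (Real.sqrt κ : ℂ) * (ξ k ω : ℂ)) ^ 2
          - 2 * ((t (k + 1) - t k : ℝ) : ℂ))
    (hZint : ∀ k ≤ N, Integrable (fun ω => Z k ω ^ 2) P)
    (hSint : ∀ k < N, Integrable (S k) P)
    (hξmeas : ∀ k < N, Measurable (ξ k))
    (hξlaw : ∀ k < N,
      Measure.map (ξ k) P = gaussianReal 0 (Real.toNNReal (t (k + 1) - t k)))
    (hindep : ∀ k < N, IndepFun (S k) (ξ k) P) :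
    ∀ k ≤ N, ∫ ω, Z k ω ^ 2 ∂P
      = (∫ ω, Z 0 ω ^ 2 ∂P) + ((κ : ℂ) - 4) * ((t k : ℝ) : ℂ) := by
  intro k
  induction k with
  | zero => simp [ht0]
  | succ k ih =>
    intro hk
    have hkN : k < N := hk
    have hlaw : HasLaw (ξ k) (gaussianReal 0 (Real.toNNReal (t (k + 1) - t k))) P :=
      ⟨(hξmeas k hkN).aemeasurable, hξlaw k hkN⟩
    have hS2 : Integrable (fun ω => S k ω ^ 2) P :=
      ((hZint k hkN.le).sub (integrable_const _)).congr
        (Filter.EventuallyEq.symm (hSsq k hkN))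
    have hmean : ∫ ω, ξ k ω ∂P = 0 := by rw [hlaw.integral_eq, integral_id_gaussianReal]
    obtain ⟨hint, heq⟩ := (hindep k hkN).integral_add_mul_ofReal_sq (hSint k hkN) hS2
      (hlaw.memLp_gaussianReal 2) hmean (Real.sqrt κ : ℂ)
    have hκ2 : (Real.sqrt κ : ℂ) ^ 2 = (κ : ℂ) := by
      rw [← ofReal_pow, Real.sq_sqrt hκ.le]
    rw [integral_congr_ae (hstep k hkN), integral_sub hint (integrable_const _), heq,
      integral_congr_ae (hSsq k hkN), integral_sub (hZint k hkN.le) (integrable_const _),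
      ih hkN.le, hlaw.integral_sq_gaussianReal,
      Real.coe_toNNReal _ (sub_nonneg.2 (hmono k hkN).le), hκ2]
    simp only [integral_const, probReal_univ, one_smul]
    push_cast
    ring
end
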